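/- The stabilizer $\widehat{K} = \{M \in \widehat{G} \mid M\langle iI_2\rangle = iI_2\}$ equals the set of matrices $\begin{pmatrix} a_1 & a_2 & b_1 & b_2 \\ \varepsilon a_2 & \varepsilon a_1 & \varepsilon b_2 & \varepsilon b_1 \\ -b_1 & -b_2 & a_1 & a_2 \\ -\varepsilon b_2 & -\varepsilon b_1 & \varepsilon a_2 & \varepsilon a_1 \end{pmatrix}$ with $\varepsilon \in \{1,-1\}$, $a_1^2 + a_2^2 + b_1^2 + b_2^2 = 1$ and $a_1a_2 + b_1b_2 = 0$. -/

import Mathlib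

open Matrix Complex

noncomputable section

/-- `J₄ = [[0, I₂], [-I₂, 0]]`. -/
def J4 : Matrix (Fin 4) (Fin 4) ℝ :=
  !![0,0,1,0; 0,0,0,1; -1,0,0,0; 0,-1,0,0]

/-- The symplectic group `Sp(4,ℝ)`. -/
def Sp4 : Set (Matrix (Fin 4) (Fin 4) ℝ) :=
  {M | IsUnit M.det ∧ Mᵀ * J4 * M = J4}

/-- `Q = [[q, 0], [0, q]]` with `q = [[0,1],[1,0]]`. -/
def QM : Matrix (Fin 4) (Fin 4) ℝ :=
  !![0,1,0,0; 1,0,0,0; 0,0,0,1; 0,0,1,0]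

/-- Upper-left 2×2 block (complexified). -/
def blkA (M : Matrix (Fin 4) (Fin 4) ℝ) : Matrix (Fin 2) (Fin 2) ℂ :=
  Matrix.of fun i j => (M (Fin.castAdd 2 i) (Fin.castAdd 2 j) : ℂ)

def blkB (M : Matrix (Fin 4) (Fin 4) ℝ) : Matrix (Fin 2) (Fin 2) ℂ :=
  Matrix.of fun i j => (M (Fin.castAdd 2 i) (Fin.natAdd 2 j) : ℂ)

def blkC (M : Matrix (Fin 4) (Fin 4) ℝ) : Matrix (Fin 2) (Fin 2) ℂ :=
  Matrix.of fun i j => (M (Fin.natAdd 2 i) (Fin.castAdd 2 j) : ℂ)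

def blkD (M : Matrix (Fin 4) (Fin 4) ℝ) : Matrix (Fin 2) (Fin 2) ℂ :=
  Matrix.of fun i j => (M (Fin.natAdd 2 i) (Fin.natAdd 2 j) : ℂ)

/-- The action `M⟨Ω⟩ = (AΩ + B)(CΩ + D)⁻¹`. -/
def act (M : Matrix (Fin 4) (Fin 4) ℝ) (Ω : Matrix (Fin 2) (Fin 2) ℂ) :
    Matrix (Fin 2) (Fin 2) ℂ :=
  (blkA M * Ω + blkB M) * (blkC M * Ω + blkD M)⁻¹

/-- The Siegel upper half plane of degree 2. -/
def H2 : Set (Matrix (Fin 2) (Fin 2) ℂ) :=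
  {Ω | Ωᵀ = Ω ∧ (Matrix.of fun i j => (Ω i j).im : Matrix (Fin 2) (Fin 2) ℝ).PosDef}

/-- The new kind Siegel upper half space `Ĥ₂ = {Ω ∈ H₂ | Q⟨Ω⟩ = Ω}`. -/
def HHat2 : Set (Matrix (Fin 2) (Fin 2) ℂ) :=
  {Ω | Ω ∈ H2 ∧ act QM Ω = Ω}

/-- `Ĝ = {M ∈ Sp(4,ℝ) | MQ = ±QM}`. -/
def GHat : Set (Matrix (Fin 4) (Fin 4) ℝ) :=
  {M | M ∈ Sp4 ∧ (M * QM = QM * M ∨ M * QM = -(QM * M))}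

/-- `M⟨iI₂⟩ = iI₂` iff `Ci + D` is invertible, `D = A` and `C = -B`. -/
lemma act_I_smul_one_eq_iff (M : Matrix (Fin 4) (Fin 4) ℝ) :
    act M (Complex.I • (1 : Matrix (Fin 2) (Fin 2) ℂ)) =
        Complex.I • (1 : Matrix (Fin 2) (Fin 2) ℂ) ↔
      IsUnit (blkC M * (Complex.I • (1 : Matrix (Fin 2) (Fin 2) ℂ)) + blkD M).det ∧
        M 2 2 = M 0 0 ∧ M 2 3 = M 0 1 ∧ M 3 2 = M 1 0 ∧ M 3 3 = M 1 1 ∧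
        M 2 0 = -M 0 2 ∧ M 2 1 = -M 0 3 ∧ M 3 0 = -M 1 2 ∧ M 3 1 = -M 1 3 := by
  have key : blkA M * (Complex.I • (1 : Matrix (Fin 2) (Fin 2) ℂ)) + blkB M =
      Complex.I • (1 : Matrix (Fin 2) (Fin 2) ℂ) *
        (blkC M * (Complex.I • (1 : Matrix (Fin 2) (Fin 2) ℂ)) + blkD M) ↔
      M 2 2 = M 0 0 ∧ M 2 3 = M 0 1 ∧ M 3 2 = M 1 0 ∧ M 3 3 = M 1 1 ∧
        M 2 0 = -M 0 2 ∧ M 2 1 = -M 0 3 ∧ M 3 0 = -M 1 2 ∧ M 3 1 = -M 1 3 := by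
    rw [← Matrix.ext_iff]
    simp [Fin.forall_fin_two, blkA, blkB, blkC, blkD, Complex.ext_iff]
    constructor
    · rintro ⟨⟨⟨_, _⟩, _, _⟩, ⟨_, _⟩, _, _⟩
      refine ⟨?_, ?_, ?_, ?_, ?_, ?_, ?_, ?_⟩ <;> linarith
    · rintro ⟨_, _, _, _, _, _, _, _⟩
      refine ⟨⟨⟨?_, ?_⟩, ?_, ?_⟩, ⟨?_, ?_⟩, ?_, ?_⟩ <;> linarith
  rw [← key, act]
  constructor
  · intro h
    have hu : IsUnit (blkC M * (Complex.I • (1 : Matrix (Fin 2) (Fin 2) ℂ)) + blkD M).det := by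
      by_contra hn
      rw [Matrix.nonsing_inv_apply_not_isUnit _ hn, Matrix.mul_zero] at h
      exact Complex.I_ne_zero (by simpa using (congrFun (congrFun h 0) 0).symm)
    refine ⟨hu, ?_⟩
    rw [← congrArg (· * (blkC M * (Complex.I • (1 : Matrix (Fin 2) (Fin 2) ℂ)) + blkD M)) h]
    exact (Matrix.nonsing_inv_mul_cancel_right _ _ hu).symm
  · rintro ⟨hu, h⟩
    rw [h, Matrix.mul_nonsing_inv_cancel_right _ _ hu]

/-- Any real matrix preserving `J4` has invertible determinant. -/
lemma isUnit_det_of_preserves_J4 {M : Matrix (Fin 4) (Fin 4) ℝ} (h : Mᵀ * J4 * M = J4) :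
    IsUnit M.det := by
  have hJ : -J4 * J4 = 1 := by
    ext i j
    fin_cases i <;> fin_cases j <;> simp [J4, Matrix.mul_apply, Fin.sum_univ_four]
  refine Matrix.isUnit_det_of_left_inverse (B := -J4 * (Mᵀ * J4)) ?_
  rw [Matrix.mul_assoc, h, hJ]

/-- the stabilizer `K̂ = {M ∈ Ĝ | M⟨iI₂⟩ = iI₂}` consists exactly of
the matrices of the displayed shape with `a₁² + a₂² + b₁² + b₂² = 1` and
`a₁a₂ + b₁b₂ = 0`. -/
theorem statement11 :
    {M | M ∈ GHat ∧
        act M (Complex.I • (1 : Matrix (Fin 2) (Fin 2) ℂ)) =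
          Complex.I • (1 : Matrix (Fin 2) (Fin 2) ℂ)} =
    {M : Matrix (Fin 4) (Fin 4) ℝ |
        ∃ ε a1 a2 b1 b2 : ℝ, (ε = 1 ∨ ε = -1) ∧
          a1^2 + a2^2 + b1^2 + b2^2 = 1 ∧
          a1*a2 + b1*b2 = 0 ∧
          M = !![a1, a2, b1, b2;
                 ε*a2, ε*a1, ε*b2, ε*b1;
                 -b1, -b2, a1, a2;
                 -(ε*b2), -(ε*b1), ε*a2, ε*a1]} := by
  ext M
  simp only [Set.mem_ofPred_eq, GHat, Sp4, act_I_smul_one_eq_iff]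
  constructor
  · rintro ⟨⟨⟨-, hJ⟩, hQ⟩, -, h22, h23, h32, h33, h20, h21, h30, h31⟩
    obtain ⟨ε, hε, h10, h11, h12, h13⟩ : ∃ ε : ℝ, (ε = 1 ∨ ε = -1) ∧
        M 1 0 = ε * M 0 1 ∧ M 1 1 = ε * M 0 0 ∧ M 1 2 = ε * M 0 3 ∧ M 1 3 = ε * M 0 2 := by
      rcases hQ with hQ | hQ
      · refine ⟨1, Or.inl rfl, ?_⟩
        have e0 := congrFun (congrFun hQ 0) 0
        have e1 := congrFun (congrFun hQ 0) 1
        have e2 := congrFun (congrFun hQ 0) 2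
        have e3 := congrFun (congrFun hQ 0) 3
        simp [QM, Matrix.mul_apply, Fin.sum_univ_four] at e0 e1 e2 e3
        refine ⟨?_, ?_, ?_, ?_⟩ <;> linarith
      · refine ⟨-1, Or.inr rfl, ?_⟩
        have e0 := congrFun (congrFun hQ 0) 0
        have e1 := congrFun (congrFun hQ 0) 1
        have e2 := congrFun (congrFun hQ 0) 2
        have e3 := congrFun (congrFun hQ 0) 3
        simp [QM, Matrix.mul_apply, Matrix.vecMul, dotProduct, Fin.sum_univ_four] at e0 e1 e2 e3
        refine ⟨?_, ?_, ?_, ?_⟩ <;> linarith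
    have hε2 : ε ^ 2 = 1 := by rcases hε with rfl | rfl <;> norm_num
    have e02 := congrFun (congrFun hJ 0) 2
    have e03 := congrFun (congrFun hJ 0) 3
    simp [J4, Matrix.mul_apply, Fin.sum_univ_four, h22, h23, h32, h33, h20, h30,
      h10, h11, h12, h13] at e02 e03
    refine ⟨ε, M 0 0, M 0 1, M 0 2, M 0 3, hε, ?_, ?_, ?_⟩
    · linear_combination e02 - (M 0 1 ^ 2 + M 0 3 ^ 2) * hε2
    · linear_combination (1 / 2) * e03 - (1 / 2) * (M 0 0 * M 0 1 + M 0 2 * M 0 3) * hε2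
    · ext i j
      fin_cases i <;> fin_cases j <;> simp [*]
  · rintro ⟨ε, a1, a2, b1, b2, hε, h1, h2, rfl⟩
    have hε2 : ε ^ 2 = 1 := by rcases hε with rfl | rfl <;> norm_num
    have hJ : (!![a1, a2, b1, b2;
                 ε*a2, ε*a1, ε*b2, ε*b1;
                 -b1, -b2, a1, a2;
                 -(ε*b2), -(ε*b1), ε*a2, ε*a1])ᵀ * J4 *
               !![a1, a2, b1, b2;
                 ε*a2, ε*a1, ε*b2, ε*b1;
                 -b1, -b2, a1, a2;
                 -(ε*b2), -(ε*b1), ε*a2, ε*a1] = J4 := by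
      ext i j
      rcases hε with rfl | rfl <;> fin_cases i <;> fin_cases j <;>
        simp [J4, Matrix.mul_apply, Fin.sum_univ_four] <;> linarith
    refine ⟨⟨⟨isUnit_det_of_preserves_J4 hJ, hJ⟩, ?_⟩, ?_, ?_⟩
    · rcases hε with rfl | rfl
      · left
        ext i j
        fin_cases i <;> fin_cases j <;> simp [QM, Matrix.mul_apply, Fin.sum_univ_four]
      · right
        ext i j
        fin_cases i <;> fin_cases j <;> simp [QM, Matrix.mul_apply, Fin.sum_univ_four]
    · have h1' : (a1 : ℂ) ^ 2 + a2 ^ 2 + b1 ^ 2 + b2 ^ 2 = 1 := by exact_mod_cast h1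
      have h2' : (a1 : ℂ) * a2 + b1 * b2 = 0 := by exact_mod_cast h2
      have hε' : (ε : ℂ) ^ 2 = 1 := by exact_mod_cast hε2
      refine Matrix.isUnit_det_of_left_inverse
        (B := !![a1 + b1 * Complex.I, ε * (a2 + b2 * Complex.I);
                 a2 + b2 * Complex.I, ε * (a1 + b1 * Complex.I)]) ?_
      ext i j
      fin_cases i <;> fin_cases j <;>
        simp [blkC, blkD, Matrix.mul_apply, Fin.sum_univ_two]
      · linear_combination h1' + (a2 ^ 2 + b2 ^ 2 : ℂ) * hε' -
          (b1 ^ 2 + ε ^ 2 * b2 ^ 2 : ℂ) * Complex.I_sq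
      · linear_combination 2 * h2' +
          (a1 * a2 + b1 * b2 + (a1 * b2 - b1 * a2) * Complex.I : ℂ) * hε' -
          (b1 * b2 * (1 + ε ^ 2) : ℂ) * Complex.I_sq
      · linear_combination 2 * h2' +
          (a1 * a2 + b1 * b2 + (a2 * b1 - b2 * a1) * Complex.I : ℂ) * hε' -
          (b1 * b2 * (1 + ε ^ 2) : ℂ) * Complex.I_sq
      · linear_combination h1' + (a1 ^ 2 + b1 ^ 2 : ℂ) * hε' -
          (b2 ^ 2 + ε ^ 2 * b1 ^ 2 : ℂ) * Complex.I_sq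
    · simp

end
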